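/- Let β be a non-increasing weight sequence, X, U, Y complex Hilbert spaces, T ∈ L(X), E ∈ L(X,Y), N ∈ L(X,U), with (E,T) β-output stable. An analytic function S : 𝔻 → L(U,Y) is a contractive multiplier from H²(U) to H²_β(Y) satisfying the interpolation condition (E*S)^{∧L}(T*) = N* if and only if there exists 𝐒 in the Schur class S(U, ℓ²(Y)), with component Taylor coefficients 𝐒_{j,k} ∈ L(U,Y) (𝐒_j(z) = Σ_k 𝐒_{j,k} z^k being the j-th component of 𝐒), such that S(z) = Ψ_β(z) 𝐒(z) for all z ∈ 𝔻 and for every u ∈ U and x ∈ X the iterated series Σ_{k≥0} ( Σ_{j≥0} √(c_j) ⟨𝐒_{j,k} u, E T^{j+k} x⟩_Y ) converges and equals ⟨u, N x⟩_U. -/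

import Mathlib

open Metric Filter

noncomputable section

/-- `β` is a weight sequence: positive, `β 0 = 1`, and `liminf β_j^(1/j) ≥ 1`. -/
def IsWeightSeq (β : ℕ → ℝ) : Prop :=
  (∀ j, 0 < β j) ∧ β 0 = 1 ∧
    1 ≤ Filter.liminf (fun j : ℕ => β j ^ ((1 : ℝ) / j)) Filter.atTop

/-- The pair `(E,T)` is `β`-output stable. -/
def OutputStable {X Y : Type*} [NormedAddCommGroup X] [InnerProductSpace ℂ X]
    [NormedAddCommGroup Y] [InnerProductSpace ℂ Y]
    (β : ℕ → ℝ) (E : X →L[ℂ] Y) (T : X →L[ℂ] X) : Prop :=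
  ∃ C : ℝ, 0 ≤ C ∧ ∀ x : X,
    Summable (fun j => (β j)⁻¹ * ‖E ((T ^ j) x)‖ ^ 2) ∧
    ∑' j, (β j)⁻¹ * ‖E ((T ^ j) x)‖ ^ 2 ≤ C * ‖x‖ ^ 2

/-- `S`, with Taylor coefficients `Sc`, is a contractive multiplier from `H²(U)` to
`H²_β(Y)`. -/
def IsContractiveMultiplier {U Y : Type*} [NormedAddCommGroup U] [InnerProductSpace ℂ U]
    [NormedAddCommGroup Y] [InnerProductSpace ℂ Y]
    (β : ℕ → ℝ) (Sc : ℕ → (U →L[ℂ] Y)) : Prop :=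
  ∀ h : ℕ → U, Summable (fun k => ‖h k‖ ^ 2) →
    Summable (fun ℓ => β ℓ * ‖∑ j ∈ Finset.range (ℓ + 1), Sc j (h (ℓ - j))‖ ^ 2) ∧
    ∑' ℓ, β ℓ * ‖∑ j ∈ Finset.range (ℓ + 1), Sc j (h (ℓ - j))‖ ^ 2 ≤ ∑' k, ‖h k‖ ^ 2

/-- The Schur class: analytic on the unit disk with contractive values. -/
def IsSchur {U V : Type*} [NormedAddCommGroup U] [NormedSpace ℂ U]
    [NormedAddCommGroup V] [NormedSpace ℂ V] (F : ℂ → (U →L[ℂ] V)) : Prop :=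
  AnalyticOn ℂ F (ball 0 1) ∧ ∀ z ∈ ball (0 : ℂ) 1, ‖F z‖ ≤ 1


open MeasureTheory in
lemma integral_fourier_nat_mul (k l : ℕ) :
    ∫ t : UnitAddCircle, fourier (-(k : ℤ)) t * fourier (l : ℤ) t ∂AddCircle.haarAddCircle
      = if k = l then 1 else 0 := by
  have h := (orthonormal_iff_ite.1 (orthonormal_fourier (T := 1))) (k : ℤ) (l : ℤ)
  rw [ContinuousMap.inner_toLp (@AddCircle.haarAddCircle 1 _) (fourier (k : ℤ)) (fourier (l : ℤ))] at h
  simp only [← fourier_neg] at h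
  simp only [mul_comm (fourier (-(k : ℤ)) _)]
  rw [h]; simp

lemma norm_fourier_apply (n : ℤ) (t : UnitAddCircle) : ‖fourier n t‖ = 1 := by
  rw [fourier_apply]; exact Circle.norm_coe _

/-- Parseval identity for an absolutely convergent Hilbert space valued Fourier series. -/
lemma hasSum_norm_sq_fourier {H : Type*} [NormedAddCommGroup H] [InnerProductSpace ℂ H]
    [CompleteSpace H] {b : ℕ → H} (hb : Summable fun k => ‖b k‖) :
    HasSum (fun k => ‖b k‖ ^ 2)
      (∫ t : UnitAddCircle, ‖∑' k : ℕ, fourier (k : ℤ) t • b k‖ ^ 2 ∂AddCircle.haarAddCircle) := by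
  set φ : UnitAddCircle → H := fun t => ∑' k : ℕ, fourier (k : ℤ) t • b k with hφ
  have hsum : ∀ t : UnitAddCircle, Summable fun k : ℕ => fourier (k : ℤ) t • b k := fun t =>
    Summable.of_norm (by simpa only [norm_smul, norm_fourier_apply, one_mul] using hb)
  have hcont : Continuous φ := by
    refine continuous_tsum (u := fun k => ‖b k‖) (fun k => by fun_prop) hb fun k t => ?_
    rw [norm_smul, norm_fourier_apply, one_mul]
  have hbd : ∀ t, ‖φ t‖ ≤ ∑' k, ‖b k‖ := fun t =>
    tsum_of_norm_bounded hb.hasSum fun k => by rw [norm_smul, norm_fourier_apply, one_mul]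
  have hcoef : ∀ k : ℕ, ∫ t, fourier (-(k : ℤ)) t • φ t ∂AddCircle.haarAddCircle = b k := by
    intro k
    have h1 := MeasureTheory.hasSum_integral_of_summable_integral_norm
      (μ := (AddCircle.haarAddCircle : MeasureTheory.Measure UnitAddCircle))
      (F := fun (l : ℕ) t => fourier (-(k : ℤ)) t • fourier (l : ℤ) t • b l)
      (fun l => Continuous.integrable_of_hasCompactSupport (by fun_prop)
        (HasCompactSupport.of_compactSpace _))
      (by simpa only [norm_smul, norm_fourier_apply, one_mul, MeasureTheory.integral_const,
            MeasureTheory.probReal_univ, one_smul] using hb)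
    have h2 : ∀ t : UnitAddCircle, ∑' l : ℕ, fourier (-(k : ℤ)) t • fourier (l : ℤ) t • b l =
        fourier (-(k : ℤ)) t • φ t := fun t => (hsum t).tsum_const_smul _
    rw [MeasureTheory.integral_congr_ae (Filter.Eventually.of_forall h2)] at h1
    simp only [smul_smul, integral_smul_const, integral_fourier_nat_mul] at h1
    refine h1.unique ?_
    convert hasSum_ite_eq k (b k) using 2 with l
    by_cases h : k = l
    · subst h; simp
    · simp [h, Ne.symm h]
  have h3 := MeasureTheory.hasSum_integral_of_summable_integral_norm
      (μ := (AddCircle.haarAddCircle : MeasureTheory.Measure UnitAddCircle))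
      (F := fun (k : ℕ) t => inner ℂ (b k) (fourier (-(k : ℤ)) t • φ t))
      (fun l => Continuous.integrable_of_hasCompactSupport (by fun_prop)
        (HasCompactSupport.of_compactSpace _)) (by
        refine Summable.of_nonneg_of_le
          (fun k => MeasureTheory.integral_nonneg fun t => norm_nonneg _) (fun k => ?_)
          (hb.mul_right (∑' k, ‖b k‖))
        calc _ ≤ ∫ t : UnitAddCircle, ‖b k‖ * (∑' k, ‖b k‖) ∂AddCircle.haarAddCircle := by
              refine MeasureTheory.integral_mono ?_ ?_
                fun t => (norm_inner_le_norm _ _).trans ?_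
              · apply Continuous.integrable_of_hasCompactSupport (by fun_prop)
                  (HasCompactSupport.of_compactSpace _)
              · apply MeasureTheory.integrable_const
              rw [norm_smul, norm_fourier_apply, one_mul]
              exact mul_le_mul_of_nonneg_left (hbd t) (norm_nonneg _)
          _ = _ := by simp)
  have h4 : ∀ t : UnitAddCircle, ∑' k : ℕ, inner ℂ (b k) (fourier (-(k : ℤ)) t • φ t) =
      ((‖φ t‖ ^ 2 : ℝ) : ℂ) := by
    intro t
    have : HasSum _ (innerSLFlip ℂ (φ t) (φ t)) :=
      (innerSLFlip ℂ (φ t)).hasSum (hsum t).hasSum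
    have h5 : HasSum (fun k : ℕ => inner ℂ (b k) (fourier (-(k : ℤ)) t • φ t))
        (inner ℂ (φ t) (φ t)) := by
      simpa only [innerSLFlip_apply_apply, inner_smul_left, inner_smul_right, fourier_neg]
        using this
    rw [h5.tsum_eq, inner_self_eq_norm_sq_to_K]; push_cast; rfl
  rw [MeasureTheory.integral_congr_ae (Filter.Eventually.of_forall h4),
    integral_complex_ofReal] at h3
  rw [← Complex.hasSum_ofReal]
  have h5 : ∀ k : ℕ, ∫ t : UnitAddCircle, inner ℂ (b k) (fourier (-(k : ℤ)) t • φ t)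
      ∂AddCircle.haarAddCircle = ((‖b k‖ ^ 2 : ℝ) : ℂ) := fun k => by
    rw [integral_inner, hcoef, inner_self_eq_norm_sq_to_K]
    · push_cast; rfl
    · apply Continuous.integrable_of_hasCompactSupport (by fun_prop)
        (HasCompactSupport.of_compactSpace _)
  simpa only [h5] using h3

lemma summable_norm_pow_smul_of_hasSum {H : Type*} [NormedAddCommGroup H] [NormedSpace ℂ H]
    {a : ℕ → H} {f : ℂ → H} (hf : ∀ z ∈ ball (0 : ℂ) 1, HasSum (fun k => z ^ k • a k) (f z))
    {r : ℝ} (hr0 : 0 ≤ r) (hr1 : r < 1) : Summable fun k => r ^ k * ‖a k‖ := by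
  obtain ⟨ρ, hρ, hρ1⟩ := exists_between hr1
  have hρ0 : 0 < ρ := hr0.trans_lt hρ
  have h := (hf (ρ : ℂ) (by simpa [abs_of_pos hρ0] using hρ1)).summable.tendsto_atTop_zero
  obtain ⟨C, hC⟩ := h.norm.bddAbove_range
  have hC' : ∀ k, ρ ^ k * ‖a k‖ ≤ C := fun k => by
    simpa [norm_smul, abs_of_pos hρ0] using hC ⟨k, rfl⟩
  refine Summable.of_nonneg_of_le (fun k => by positivity) (fun k => ?_)
    ((summable_geometric_of_lt_one (by positivity) ((div_lt_one hρ0).2 hρ)).mul_right C)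
  calc r ^ k * ‖a k‖ = (r / ρ) ^ k * (ρ ^ k * ‖a k‖) := by
        rw [div_pow]; field_simp
    _ ≤ _ := mul_le_mul_of_nonneg_left (hC' k) (by positivity)

lemma real_mul_fourier_mem_ball {r : ℝ} (hr0 : 0 ≤ r) (hr1 : r < 1) (t : UnitAddCircle) :
    (r : ℂ) * fourier 1 t ∈ ball (0 : ℂ) 1 := by
  rwa [mem_ball_zero_iff, norm_mul, norm_fourier_apply, mul_one, Complex.norm_real,
    Real.norm_of_nonneg hr0]

/-- Parseval identity on the circle of radius `r < 1`, with continuity of the integrand. -/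
lemma hasSum_norm_sq_circle {H : Type*} [NormedAddCommGroup H] [InnerProductSpace ℂ H]
    [CompleteSpace H] {a : ℕ → H} {f : ℂ → H}
    (hf : ∀ z ∈ ball (0 : ℂ) 1, HasSum (fun k => z ^ k • a k) (f z))
    {r : ℝ} (hr0 : 0 ≤ r) (hr1 : r < 1) :
    Continuous (fun t : UnitAddCircle => f (r * fourier 1 t)) ∧
    HasSum (fun k => (r ^ k) ^ 2 * ‖a k‖ ^ 2)
      (∫ t : UnitAddCircle, ‖f (r * fourier 1 t)‖ ^ 2 ∂AddCircle.haarAddCircle) := by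
  have hb : Summable fun k => ‖(r : ℂ) ^ k • a k‖ := by
    simpa [norm_smul, abs_of_nonneg hr0] using summable_norm_pow_smul_of_hasSum hf hr0 hr1
  have hfe : ∀ t : UnitAddCircle, f (r * fourier 1 t) =
      ∑' k : ℕ, fourier (k : ℤ) t • (r : ℂ) ^ k • a k := fun t => by
    rw [← (hf _ (real_mul_fourier_mem_ball hr0 hr1 t)).tsum_eq]
    refine tsum_congr fun k => ?_
    have : fourier (k : ℤ) t = fourier 1 t ^ k := by
      simp only [fourier_apply, natCast_zsmul, one_smul, AddCircle.toCircle_nsmul]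
      push_cast; rfl
    rw [this, mul_pow, smul_smul, mul_comm]
  constructor
  · simp only [hfe]
    refine continuous_tsum (u := fun k => ‖(r : ℂ) ^ k • a k‖) (fun k => by fun_prop) hb
      fun k t => ?_
    rw [norm_smul, norm_fourier_apply, one_mul]
  · simp only [hfe]
    convert hasSum_norm_sq_fourier hb using 2 with k
    simp [norm_smul, mul_pow, abs_of_nonneg hr0]

lemma coeff_eq_zero_of_hasSum_zero {H : Type*} [NormedAddCommGroup H] [InnerProductSpace ℂ H]
    [CompleteSpace H] {a : ℕ → H}
    (hf : ∀ z ∈ ball (0 : ℂ) 1, HasSum (fun k => z ^ k • a k) 0) (k : ℕ) : a k = 0 := by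
  have h := (hasSum_norm_sq_circle (f := fun _ => 0) hf (r := 1 / 2) (by norm_num)
    (by norm_num)).2
  simp only [norm_zero, ne_eq, OfNat.ofNat_ne_zero, not_false_eq_true, zero_pow,
    MeasureTheory.integral_zero] at h
  have := (hasSum_zero_iff_of_nonneg (fun k => by positivity)).1 h
  simpa using congrFun this k


lemma lp_two_hasSum_norm_sq {Y : Type*} [NormedAddCommGroup Y] (v : lp (fun _ : ℕ => Y) 2) :
    HasSum (fun j => ‖v j‖ ^ 2) (‖v‖ ^ 2) := by
  simpa using lp.hasSum_norm (p := 2) (by simp) v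

/-- Multiplication by a Schur class function is contractive from `H²(U)` to `H²(ℓ²(Y))`. -/
lemma sum_norm_sq_mul_le_of_schur {U Y : Type*}
    [NormedAddCommGroup U] [InnerProductSpace ℂ U] [CompleteSpace U]
    [NormedAddCommGroup Y] [InnerProductSpace ℂ Y] [CompleteSpace Y]
    {F : ℂ → (U →L[ℂ] lp (fun _ : ℕ => Y) 2)} {Fc : ℕ → ℕ → (U →L[ℂ] Y)}
    (hF : ∀ z ∈ ball (0 : ℂ) 1, ‖F z‖ ≤ 1)
    (hFc : ∀ (j : ℕ), ∀ z ∈ ball (0 : ℂ) 1, ∀ u : U,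
        HasSum (fun k => z ^ k • Fc j k u) ((F z u) j)) (h : ℕ → U) (J L : ℕ) :
    ∑ j ∈ Finset.range J, ∑ l ∈ Finset.range L,
      ‖∑ p ∈ Finset.HasAntidiagonal.antidiagonal l, Fc j p.1 (h p.2)‖ ^ 2 ≤
      ∑ k ∈ Finset.range L, ‖h k‖ ^ 2 := by
  set P : ℂ → U := fun z => ∑ k ∈ Finset.range L, z ^ k • h k with hP
  set a : ℕ → ℕ → Y := fun j l =>
    ∑ k ∈ Finset.range L, if k ≤ l then Fc j (l - k) (h k) else 0 with ha
  have hprod : ∀ j, ∀ z ∈ ball (0 : ℂ) 1, HasSum (fun l => z ^ l • a j l) ((F z (P z)) j) := by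
    intro j z hz
    have h1 : ∀ k ∈ Finset.range L, HasSum
        (fun l => z ^ l • (if k ≤ l then Fc j (l - k) (h k) else 0)) ((F z (z ^ k • h k)) j) := by
      intro k _
      have h2 := (hFc j z hz (h k)).const_smul (z ^ k)
      refine ((add_left_injective k).hasSum_iff ?_).1 ?_
      · intro l hl
        rw [if_neg, smul_zero]
        intro hkl
        exact hl ⟨l - k, Nat.sub_add_cancel hkl⟩
      · convert h2 using 1
        · ext l
          simp [pow_add, smul_smul, mul_comm]
        · simp
    have h3 := hasSum_sum h1
    convert h3 using 1
    · ext l; simp [ha, Finset.smul_sum]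
    · simp only [hP, map_sum]
      exact map_sum (lp.evalCLM ℂ (fun _ : ℕ => Y) 2 j) _ _
  have hpoly : ∀ z ∈ ball (0 : ℂ) 1,
      HasSum (fun k => z ^ k • (if k < L then h k else 0)) (P z) := by
    intro z _
    have : P z = ∑ k ∈ Finset.range L, z ^ k • (if k < L then h k else 0) :=
      Finset.sum_congr rfl fun k hk => by rw [if_pos (Finset.mem_range.1 hk)]
    rw [this]
    exact hasSum_sum_of_ne_finset_zero fun k hk => by
      rw [if_neg (by simpa using hk), smul_zero]
  have hcoef : ∀ j, ∀ l ∈ Finset.range L,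
      ∑ p ∈ Finset.HasAntidiagonal.antidiagonal l, Fc j p.1 (h p.2) = a j l := by
    intro j l hl
    rw [Finset.Nat.sum_antidiagonal_eq_sum_range_succ_mk, ha, ← Finset.sum_range_reflect]
    simp only [← Finset.sum_filter]
    have : Finset.filter (fun k => k ≤ l) (Finset.range L) = Finset.range (l + 1) := by
      ext k; simp at hl ⊢; omega
    rw [this]
    refine Finset.sum_congr rfl fun k hk => ?_
    have hk' : k ≤ l := by simpa [Nat.lt_succ_iff] using hk
    have e1 : l + 1 - 1 - k = l - k := by omega
    have e2 : l - (l - k) = k := by omega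
    rw [e1, e2]
  have hr : ∀ r ∈ Set.Ico (0 : ℝ) 1, ∑ j ∈ Finset.range J, ∑ l ∈ Finset.range L,
      (r ^ l) ^ 2 * ‖a j l‖ ^ 2 ≤ ∑ k ∈ Finset.range L, ‖h k‖ ^ 2 := by
    rintro r ⟨hr0, hr1⟩
    have hA := fun j => hasSum_norm_sq_circle (f := fun z => (F z (P z)) j) (hprod j) hr0 hr1
    have hB := hasSum_norm_sq_circle hpoly hr0 hr1
    calc _ ≤ ∑ j ∈ Finset.range J, ∫ t : UnitAddCircle,
            ‖(F (r * fourier 1 t) (P (r * fourier 1 t))) j‖ ^ 2 ∂AddCircle.haarAddCircle :=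
          Finset.sum_le_sum fun j _ => sum_le_hasSum _ (fun _ _ => by positivity) (hA j).2
      _ = ∫ t : UnitAddCircle, ∑ j ∈ Finset.range J,
            ‖(F (r * fourier 1 t) (P (r * fourier 1 t))) j‖ ^ 2 ∂AddCircle.haarAddCircle := by
          rw [MeasureTheory.integral_finsetSum]
          intro j _
          exact Continuous.integrable_of_hasCompactSupport ((hA j).1.norm.pow 2)
            (HasCompactSupport.of_compactSpace _)
      _ ≤ ∫ t : UnitAddCircle, ‖P (r * fourier 1 t)‖ ^ 2 ∂AddCircle.haarAddCircle := by
          refine MeasureTheory.integral_mono ?_ ?_ fun t => ?_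
          · exact Continuous.integrable_of_hasCompactSupport
              (continuous_finsetSum _ fun j _ => (hA j).1.norm.pow 2)
              (HasCompactSupport.of_compactSpace _)
          · exact Continuous.integrable_of_hasCompactSupport (hB.1.norm.pow 2)
              (HasCompactSupport.of_compactSpace _)
          · have hz := real_mul_fourier_mem_ball hr0 hr1 t
            set z : ℂ := r * fourier 1 t
            calc _ ≤ ‖F z (P z)‖ ^ 2 :=
                  sum_le_hasSum _ (fun _ _ => by positivity) (lp_two_hasSum_norm_sq (F z (P z)))
              _ ≤ _ := by
                have := (F z).le_of_opNorm_le (hF z hz) (P z)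
                rw [one_mul] at this
                gcongr
      _ = ∑ k ∈ Finset.range L, (r ^ k) ^ 2 * ‖h k‖ ^ 2 := by
          refine hB.2.unique ?_
          have : ∑ k ∈ Finset.range L, (r ^ k) ^ 2 * ‖h k‖ ^ 2 =
              ∑ k ∈ Finset.range L, (r ^ k) ^ 2 * ‖if k < L then h k else 0‖ ^ 2 :=
            Finset.sum_congr rfl fun k hk => by rw [if_pos (Finset.mem_range.1 hk)]
          rw [this]
          exact hasSum_sum_of_ne_finset_zero fun k hk => by
            rw [if_neg (by simpa using hk)]; simp
      _ ≤ _ := by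
          refine Finset.sum_le_sum fun k _ => mul_le_of_le_one_left (by positivity) ?_
          exact pow_le_one₀ (by positivity) (pow_le_one₀ hr0 hr1.le)
  have hlim : Tendsto (fun r : ℝ => ∑ j ∈ Finset.range J, ∑ l ∈ Finset.range L,
      (r ^ l) ^ 2 * ‖a j l‖ ^ 2) (nhdsWithin 1 (Set.Iio 1))
      (nhds (∑ j ∈ Finset.range J, ∑ l ∈ Finset.range L, ((1 : ℝ) ^ l) ^ 2 * ‖a j l‖ ^ 2)) :=
    (Continuous.tendsto (by fun_prop) 1).mono_left nhdsWithin_le_nhds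
  have hfin := le_of_tendsto hlim
    (Filter.mem_of_superset (Ico_mem_nhdsLT (zero_lt_one' ℝ)) hr)
  simp only [one_pow, one_mul] at hfin
  refine le_trans (le_of_eq ?_) hfin
  exact Finset.sum_congr rfl fun j _ => Finset.sum_congr rfl fun l hl => by rw [hcoef j l hl]

/-- The Taylor coefficients of a Schur class function are square summable on each vector. -/
lemma summable_norm_sq_coeff_of_schur {U Y : Type*}
    [NormedAddCommGroup U] [InnerProductSpace ℂ U] [CompleteSpace U]
    [NormedAddCommGroup Y] [InnerProductSpace ℂ Y] [CompleteSpace Y]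
    {F : ℂ → (U →L[ℂ] lp (fun _ : ℕ => Y) 2)} {Fc : ℕ → ℕ → (U →L[ℂ] Y)}
    (hF : ∀ z ∈ ball (0 : ℂ) 1, ‖F z‖ ≤ 1)
    (hFc : ∀ (j : ℕ), ∀ z ∈ ball (0 : ℂ) 1, ∀ u : U,
        HasSum (fun k => z ^ k • Fc j k u) ((F z u) j)) (u : U) :
    Summable (fun p : ℕ × ℕ => ‖Fc p.1 p.2 u‖ ^ 2) := by
  refine summable_of_sum_le (c := ‖u‖ ^ 2) (fun p => by positivity) fun s => ?_
  obtain ⟨n, hn⟩ : ∃ n, s ⊆ Finset.range (n + 1) ×ˢ Finset.range (n + 1) := by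
    refine ⟨s.sup fun p => p.1 + p.2, fun p hp => ?_⟩
    have := Finset.le_sup (f := fun p : ℕ × ℕ => p.1 + p.2) hp
    simp only [Finset.mem_product, Finset.mem_range]
    omega
  have key := sum_norm_sq_mul_le_of_schur hF hFc (fun k => if k = 0 then u else 0) (n + 1) (n + 1)
  calc _ ≤ ∑ p ∈ Finset.range (n + 1) ×ˢ Finset.range (n + 1), ‖Fc p.1 p.2 u‖ ^ 2 :=
        Finset.sum_le_sum_of_subset_of_nonneg hn fun _ _ _ => by positivity
    _ ≤ _ := by
        rw [Finset.sum_product]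
        convert key using 1
        · refine Finset.sum_congr rfl fun j _ => Finset.sum_congr rfl fun l _ => ?_
          congr 2
          rw [Finset.sum_eq_single (l, 0)]
          · simp
          · rintro ⟨x, y⟩ hp hne
            have : y ≠ 0 := by
              rintro rfl; simp at hp; exact hne (by simp [hp])
            simp [this]
          · intro hp; simp at hp
        · simp [Finset.sum_range_succ']

section Weights

variable {β c : ℕ → ℝ}

lemma sum_range_weight_increments (hβ : IsWeightSeq β) (hc0 : c 0 = 1)
    (hcs : ∀ j, c (j + 1) = (β (j + 1))⁻¹ - (β j)⁻¹) (n : ℕ) :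
    ∑ j ∈ Finset.range (n + 1), c j = (β n)⁻¹ := by
  induction n with
  | zero => simp [hc0, hβ.2.1]
  | succ n ih => rw [Finset.sum_range_succ, ih, hcs]; ring

lemma weight_increment_nonneg (hβ : IsWeightSeq β) (hmono : ∀ j, β (j + 1) ≤ β j)
    (hc0 : c 0 = 1) (hcs : ∀ j, c (j + 1) = (β (j + 1))⁻¹ - (β j)⁻¹) (j : ℕ) : 0 ≤ c j := by
  cases j with
  | zero => simp [hc0]
  | succ j => rw [hcs, sub_nonneg]; exact inv_anti₀ (hβ.1 _) (hmono j)

lemma weight_le_one (hβ : IsWeightSeq β) (hmono : ∀ j, β (j + 1) ≤ β j) (n : ℕ) : β n ≤ 1 := by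
  rw [← hβ.2.1]; exact antitone_nat_of_succ_le hmono (Nat.zero_le n)

lemma sqrt_weight_increment_le (hβ : IsWeightSeq β) (hmono : ∀ j, β (j + 1) ≤ β j)
    (hc0 : c 0 = 1) (hcs : ∀ j, c (j + 1) = (β (j + 1))⁻¹ - (β j)⁻¹) (j : ℕ) :
    √(c j) ≤ (β j)⁻¹ := by
  have h1 : c j ≤ (β j)⁻¹ := by
    rw [← sum_range_weight_increments hβ hc0 hcs]
    exact Finset.single_le_sum (f := c)
      (fun i _ => weight_increment_nonneg hβ hmono hc0 hcs i) (Finset.self_mem_range_succ j)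
  have h2 : 1 ≤ (β j)⁻¹ := (one_le_inv₀ (hβ.1 j)).2 (weight_le_one hβ hmono j)
  refine Real.sqrt_le_iff.2 ⟨by linarith, h1.trans ?_⟩
  nlinarith

lemma summable_sqrt_weight_increment_mul_pow (hβ : IsWeightSeq β)
    (hmono : ∀ j, β (j + 1) ≤ β j)
    (hc0 : c 0 = 1) (hcs : ∀ j, c (j + 1) = (β (j + 1))⁻¹ - (β j)⁻¹)
    {r : ℝ} (hr0 : 0 ≤ r) (hr1 : r < 1) : Summable fun j => √(c j) * r ^ j := by
  obtain ⟨q, hq, hq1⟩ := exists_between hr1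
  have hq0 : 0 < q := hr0.trans_lt hq
  have hev : ∀ᶠ j : ℕ in atTop, q < β j ^ ((1 : ℝ) / j) :=
    eventually_lt_of_lt_liminf (hq1.trans_le hβ.2.2)
      (isBoundedUnder_of ⟨0, fun j => Real.rpow_nonneg (hβ.1 j).le _⟩)
  refine Summable.of_norm_bounded_eventually_nat
    (summable_geometric_of_lt_one (by positivity) ((div_lt_one hq0).2 hq)) ?_
  filter_upwards [hev, eventually_gt_atTop 0] with j hj hj0
  have h1 : q ^ j ≤ β j := by
    have := pow_le_pow_left₀ hq0.le hj.le j
    rwa [one_div, Real.rpow_inv_natCast_pow (hβ.1 j).le hj0.ne'] at this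
  rw [Real.norm_of_nonneg (by positivity), div_pow, div_eq_inv_mul]
  refine mul_le_mul_of_nonneg_right ?_ (by positivity)
  exact (sqrt_weight_increment_le hβ hmono hc0 hcs j).trans (inv_anti₀ (by positivity) h1)

end Weights

lemma summable_of_summable_sum_antidiagonal {g : ℕ × ℕ → ℝ} (hg : ∀ p, 0 ≤ g p)
    (h : Summable fun m => ∑ p ∈ Finset.HasAntidiagonal.antidiagonal m, g p) : Summable g := by
  refine Finset.HasAntidiagonal.sigmaAntidiagonalEquivProd.summable_iff.1
    ((summable_sigma_of_nonneg fun _ => hg _).2 ?_)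
  refine ⟨fun m => Summable.of_finite, ?_⟩
  convert h using 2 with m
  rw [tsum_fintype]
  exact Finset.sum_coe_sort (Finset.HasAntidiagonal.antidiagonal m) g

lemma hasSum_sum_antidiagonal {H : Type*} [NormedAddCommGroup H] [CompleteSpace H]
    {f : ℕ × ℕ → H} (hf : Summable f) :
    HasSum (fun m => ∑ p ∈ Finset.HasAntidiagonal.antidiagonal m, f p) (∑' p, f p) := by
  have h := (Finset.HasAntidiagonal.sigmaAntidiagonalEquivProd.hasSum_iff.2 hf.hasSum).sigma
    (fun m => hasSum_fintype _)
  convert h using 2 with m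
  exact (Finset.sum_coe_sort (Finset.HasAntidiagonal.antidiagonal m) f).symm

section SchurExpansion

variable {U Y : Type*}
    [NormedAddCommGroup U] [InnerProductSpace ℂ U] [CompleteSpace U]
    [NormedAddCommGroup Y] [InnerProductSpace ℂ Y] [CompleteSpace Y]
    {β c : ℕ → ℝ} {F : ℂ → (U →L[ℂ] lp (fun _ : ℕ => Y) 2)} {Fc : ℕ → ℕ → (U →L[ℂ] Y)}

/-- Expansion of `Ψ_β(z) F(z) u`, both along the components of `F` and in powers of `z`. -/
lemma exists_hasSum_schur_expansion (hβ : IsWeightSeq β)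
    (hmono : ∀ j, β (j + 1) ≤ β j)
    (hc0 : c 0 = 1) (hcs : ∀ j, c (j + 1) = (β (j + 1))⁻¹ - (β j)⁻¹)
    (hF : ∀ z ∈ ball (0 : ℂ) 1, ‖F z‖ ≤ 1)
    (hFc : ∀ (j : ℕ), ∀ z ∈ ball (0 : ℂ) 1, ∀ u : U,
        HasSum (fun k => z ^ k • Fc j k u) ((F z u) j))
    {z : ℂ} (hz : z ∈ ball (0 : ℂ) 1) (u : U) :
    ∃ A : Y, HasSum (fun j => ((√(c j) : ℂ) * z ^ j) • (F z u) j) A ∧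
      HasSum (fun m => z ^ m • ∑ p ∈ Finset.HasAntidiagonal.antidiagonal m,
        (√(c p.1) : ℂ) • Fc p.1 p.2 u) A := by
  have hz' : ‖z‖ < 1 := by simpa using hz
  obtain ⟨C, hC⟩ : ∃ C, ∀ p : ℕ × ℕ, ‖Fc p.1 p.2 u‖ ≤ C := by
    have hs := summable_norm_sq_coeff_of_schur hF hFc u
    refine ⟨√(∑' p : ℕ × ℕ, ‖Fc p.1 p.2 u‖ ^ 2), fun p => Real.le_sqrt_of_sq_le ?_⟩
    exact hs.le_tsum p fun _ _ => by positivity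
  set f : ℕ × ℕ → Y := fun p => ((√(c p.1) : ℂ) * z ^ p.1) • z ^ p.2 • Fc p.1 p.2 u with hf
  have hfs : Summable f := by
    refine Summable.of_norm_bounded (g := fun p : ℕ × ℕ =>
      (√(c p.1) * ‖z‖ ^ p.1) * ‖z‖ ^ p.2 * C) ?_ fun p => ?_
    · refine Summable.mul_right C (Summable.mul_of_nonneg
        (summable_sqrt_weight_increment_mul_pow hβ hmono hc0 hcs (norm_nonneg z) hz')
        (summable_geometric_of_lt_one (norm_nonneg z) hz') (fun j => ?_) (fun j => ?_))
      · simp only [Pi.zero_apply]; positivity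
      · simp only [Pi.zero_apply]; positivity
    · simp only [hf, norm_smul, norm_mul, norm_pow, Complex.norm_real,
        Real.norm_of_nonneg (Real.sqrt_nonneg _), ← mul_assoc]
      exact mul_le_mul_of_nonneg_left (hC p) (by positivity)
  refine ⟨∑' p, f p, hfs.hasSum.prod_fiberwise fun j => (hFc j z hz u).const_smul _, ?_⟩
  convert hasSum_sum_antidiagonal hfs using 2 with m
  rw [Finset.smul_sum]
  refine Finset.sum_congr rfl fun p hp => ?_
  rw [← Finset.HasAntidiagonal.mem_antidiagonal.1 hp]
  simp only [hf, smul_smul]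
  congr 1; ring

/-- The two forms of the interpolation condition agree when `S = Ψ_β F`. -/
lemma interpolation_iff_of_schur {X : Type*}
    [NormedAddCommGroup X] [InnerProductSpace ℂ X] (hβ : IsWeightSeq β)
    (hmono : ∀ j, β (j + 1) ≤ β j)
    (hc0 : c 0 = 1) (hcs : ∀ j, c (j + 1) = (β (j + 1))⁻¹ - (β j)⁻¹)
    (hF : ∀ z ∈ ball (0 : ℂ) 1, ‖F z‖ ≤ 1)
    (hFc : ∀ (j : ℕ), ∀ z ∈ ball (0 : ℂ) 1, ∀ u : U,
        HasSum (fun k => z ^ k • Fc j k u) ((F z u) j))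
    {T : X →L[ℂ] X} {E : X →L[ℂ] Y} (hET : OutputStable β E T) {Sc : ℕ → (U →L[ℂ] Y)}
    (hS : ∀ m u, Sc m u = ∑ p ∈ Finset.HasAntidiagonal.antidiagonal m,
        (√(c p.1) : ℂ) • Fc p.1 p.2 u) (u : U) (x : X) (w : ℂ) :
    HasSum (fun j => inner ℂ (E ((T ^ j) x)) (Sc j u)) w ↔
      ∃ t : ℕ → ℂ, (∀ k, HasSum (fun j => (√(c j) : ℂ) *
          inner ℂ (E ((T ^ (j + k)) x)) (Fc j k u)) (t k)) ∧ HasSum t w := by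
  have hc := weight_increment_nonneg hβ hmono hc0 hcs
  set f : ℕ × ℕ → ℂ := fun p =>
    (√(c p.1) : ℂ) * inner ℂ (E ((T ^ (p.1 + p.2)) x)) (Fc p.1 p.2 u) with hf
  have hfs : Summable f := by
    obtain ⟨_, _, hx⟩ := hET
    have h1 : Summable fun p : ℕ × ℕ => c p.1 * ‖E ((T ^ (p.1 + p.2)) x)‖ ^ 2 := by
      refine summable_of_summable_sum_antidiagonal
        (fun p => mul_nonneg (hc _) (by positivity)) ?_
      convert (hx x).1 using 2 with m
      rw [← sum_range_weight_increments hβ hc0 hcs, Finset.sum_mul,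
        Finset.Nat.sum_antidiagonal_eq_sum_range_succ_mk]
      refine Finset.sum_congr rfl fun j hj => ?_
      rw [Nat.add_sub_cancel' (by simpa [Nat.lt_succ_iff] using hj)]
    refine Summable.of_norm_bounded (h1.add (summable_norm_sq_coeff_of_schur hF hFc u))
      fun p => ?_
    have h2 := norm_inner_le_norm (𝕜 := ℂ) (E ((T ^ (p.1 + p.2)) x)) (Fc p.1 p.2 u)
    have h3 := Real.sq_sqrt (hc p.1)
    simp only [hf, norm_mul, Complex.norm_real, Real.norm_of_nonneg (Real.sqrt_nonneg _)]
    have h4 := mul_le_mul_of_nonneg_left h2 (Real.sqrt_nonneg (c p.1))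
    nlinarith [sq_nonneg (√(c p.1) * ‖E ((T ^ (p.1 + p.2)) x)‖ - ‖Fc p.1 p.2 u‖),
      sq_nonneg (√(c p.1) * ‖E ((T ^ (p.1 + p.2)) x)‖), sq_nonneg ‖Fc p.1 p.2 u‖]
  have hdiag : HasSum (fun j => inner ℂ (E ((T ^ j) x)) (Sc j u)) (∑' p, f p) := by
    have h := hasSum_sum_antidiagonal hfs
    have he : (fun m => ∑ p ∈ Finset.HasAntidiagonal.antidiagonal m, f p) =
        fun j => inner ℂ (E ((T ^ j) x)) (Sc j u) := by
      ext m
      rw [hS, inner_sum]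
      refine Finset.sum_congr rfl fun p hp => ?_
      rw [inner_smul_right, hf, ← Finset.HasAntidiagonal.mem_antidiagonal.1 hp]
    rwa [he] at h
  have hsw : Summable fun p : ℕ × ℕ => f p.swap := hfs.prod_symm
  have hfib : ∀ k, HasSum (fun j => f (j, k)) (∑' j, f (j, k)) := fun k =>
    (hsw.prod_factor k).hasSum
  have hcol : HasSum (fun k => ∑' j, f (j, k)) (∑' p, f p) := by
    have h := hsw.hasSum.prod_fiberwise hfib
    have he : ∑' p : ℕ × ℕ, f p.swap = ∑' p, f p := (Equiv.prodComm ℕ ℕ).tsum_eq f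
    rwa [he] at h
  constructor
  · intro h
    rw [h.unique hdiag]
    exact ⟨_, hfib, hcol⟩
  · rintro ⟨t, ht, htw⟩
    have : t = fun k => ∑' j, f (j, k) := funext fun k => (ht k).unique (hfib k)
    rw [this] at htw
    rw [htw.unique hcol]
    exact hdiag

/-- `Ψ_β F` is a contractive multiplier when `F` is in the Schur class. -/
lemma isContractiveMultiplier_of_schur (hβ : IsWeightSeq β)
    (hmono : ∀ j, β (j + 1) ≤ β j)
    (hc0 : c 0 = 1) (hcs : ∀ j, c (j + 1) = (β (j + 1))⁻¹ - (β j)⁻¹)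
    (hF : ∀ z ∈ ball (0 : ℂ) 1, ‖F z‖ ≤ 1)
    (hFc : ∀ (j : ℕ), ∀ z ∈ ball (0 : ℂ) 1, ∀ u : U,
        HasSum (fun k => z ^ k • Fc j k u) ((F z u) j))
    {Sc : ℕ → (U →L[ℂ] Y)}
    (hS : ∀ m u, Sc m u = ∑ p ∈ Finset.HasAntidiagonal.antidiagonal m,
        (√(c p.1) : ℂ) • Fc p.1 p.2 u) : IsContractiveMultiplier β Sc := by
  intro h hh
  have hc := weight_increment_nonneg hβ hmono hc0 hcs
  set g : ℕ → ℕ → Y := fun j l =>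
    ∑ p ∈ Finset.HasAntidiagonal.antidiagonal l, Fc j p.1 (h p.2) with hg
  have hexp : ∀ l, ∑ j ∈ Finset.range (l + 1), Sc j (h (l - j)) =
      ∑ p ∈ Finset.HasAntidiagonal.antidiagonal l, (√(c p.1) : ℂ) • g p.1 p.2 := by
    intro l
    rw [← Finset.Nat.sum_antidiagonal_eq_sum_range_succ_mk
      (fun p : ℕ × ℕ => Sc p.1 (h p.2))]
    simp only [hS, hg, Finset.smul_sum]
    rw [Finset.sum_sigma', Finset.sum_sigma']
    refine Finset.sum_nbij' (fun q => ⟨(q.2.1, q.2.2 + q.1.2), (q.2.2, q.1.2)⟩)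
      (fun q => ⟨(q.1.1 + q.2.1, q.2.2), (q.1.1, q.2.1)⟩) ?_ ?_ ?_ ?_ ?_
    all_goals
      simp only [Finset.mem_sigma, Finset.HasAntidiagonal.mem_antidiagonal]
      rintro ⟨⟨a, b⟩, ⟨d, e⟩⟩ ⟨h1, h2⟩
      simp only at h1 h2 ⊢
    · exact ⟨by omega, trivial⟩
    · exact ⟨by omega, trivial⟩
    · subst h2; rfl
    · subst h2; rfl
  have hle : ∀ l, β l * ‖∑ j ∈ Finset.range (l + 1), Sc j (h (l - j))‖ ^ 2 ≤
      ∑ p ∈ Finset.HasAntidiagonal.antidiagonal l, ‖g p.1 p.2‖ ^ 2 := by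
    intro l
    have h1 : ‖∑ j ∈ Finset.range (l + 1), Sc j (h (l - j))‖ ≤
        ∑ p ∈ Finset.HasAntidiagonal.antidiagonal l, √(c p.1) * ‖g p.1 p.2‖ := by
      rw [hexp]
      refine norm_sum_le_of_le _ fun p _ => ?_
      rw [norm_smul, Complex.norm_real, Real.norm_of_nonneg (Real.sqrt_nonneg _)]
    have h2 := Finset.sum_mul_sq_le_sq_mul_sq (Finset.HasAntidiagonal.antidiagonal l)
      (fun p => √(c p.1)) (fun p => ‖g p.1 p.2‖)
    simp only [Real.sq_sqrt (hc _)] at h2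
    rw [Finset.Nat.sum_antidiagonal_eq_sum_range_succ_mk (fun p : ℕ × ℕ => c p.1) l,
      sum_range_weight_increments hβ hc0 hcs] at h2
    calc _ ≤ β l * ((β l)⁻¹ * ∑ p ∈ Finset.HasAntidiagonal.antidiagonal l, ‖g p.1 p.2‖ ^ 2) :=
          mul_le_mul_of_nonneg_left ((pow_le_pow_left₀ (norm_nonneg _) h1 2).trans h2)
            (hβ.1 l).le
      _ = _ := by rw [← mul_assoc, mul_inv_cancel₀ (hβ.1 l).ne', one_mul]
  have hpart : ∀ L, ∑ l ∈ Finset.range L,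
      β l * ‖∑ j ∈ Finset.range (l + 1), Sc j (h (l - j))‖ ^ 2 ≤ ∑' k, ‖h k‖ ^ 2 := by
    intro L
    calc _ ≤ ∑ l ∈ Finset.range L,
            ∑ p ∈ Finset.HasAntidiagonal.antidiagonal l, ‖g p.1 p.2‖ ^ 2 :=
          Finset.sum_le_sum fun l _ => hle l
      _ = ∑ q ∈ (Finset.range L).sigma fun l => Finset.HasAntidiagonal.antidiagonal l,
            ‖g q.2.1 q.2.2‖ ^ 2 := 
          (Finset.sum_sigma _ _ (fun q : (_ : ℕ) × ℕ × ℕ => ‖g q.2.1 q.2.2‖ ^ 2)).symm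
      _ = ∑ p ∈ ((Finset.range L).sigma fun l => Finset.HasAntidiagonal.antidiagonal l).image
            (fun q => q.2), ‖g p.1 p.2‖ ^ 2 := by
          rw [Finset.sum_image]
          rintro ⟨l, p⟩ hq ⟨l', p'⟩ hq' (rfl : p = p')
          simp at hq hq'
          obtain ⟨_, rfl⟩ := hq
          obtain ⟨_, rfl⟩ := hq'
          rfl
      _ ≤ ∑ p ∈ Finset.range L ×ˢ Finset.range L, ‖g p.1 p.2‖ ^ 2 := by
          refine Finset.sum_le_sum_of_subset_of_nonneg (fun p hp => ?_) fun _ _ _ => by positivity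
          simp only [Finset.mem_image, Finset.mem_sigma, Finset.mem_range,
            Finset.HasAntidiagonal.mem_antidiagonal, Sigma.exists] at hp
          obtain ⟨l, q, ⟨h1, h2⟩, rfl⟩ := hp
          simp only [Finset.mem_product, Finset.mem_range]
          omega
      _ ≤ ∑ k ∈ Finset.range L, ‖h k‖ ^ 2 := by
          rw [Finset.sum_product]
          exact sum_norm_sq_mul_le_of_schur hF hFc h L L
      _ ≤ _ := hh.sum_le_tsum _ fun _ _ => by positivity
  have hnn : ∀ l, 0 ≤ β l * ‖∑ j ∈ Finset.range (l + 1), Sc j (h (l - j))‖ ^ 2 := fun l =>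
    mul_nonneg (hβ.1 l).le (by positivity)
  exact ⟨summable_of_sum_range_le hnn hpart, Real.tsum_le_of_sum_range_le hnn hpart⟩

end SchurExpansion

/-- Douglas lemma: if `‖b y‖ ≤ ‖a y‖` for all `y`, then `b` factors through `a` by a
contraction. -/
lemma exists_contraction_factor {K A B : Type*}
    [NormedAddCommGroup K] [InnerProductSpace ℂ K]
    [NormedAddCommGroup A] [InnerProductSpace ℂ A] [CompleteSpace A]
    [NormedAddCommGroup B] [InnerProductSpace ℂ B] [CompleteSpace B]
    (a : K →L[ℂ] A) (b : K →L[ℂ] B) (h : ∀ y, ‖b y‖ ≤ ‖a y‖) :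
    ∃ V : A →L[ℂ] B, ‖V‖ ≤ 1 ∧ ∀ y, V (a y) = b y := by
  set R : Submodule ℂ A := (LinearMap.range a.toLinearMap).topologicalClosure with hR
  have hmem : ∀ y, a y ∈ R := fun y => Submodule.le_topologicalClosure _ ⟨y, rfl⟩
  set e : K →ₗ[ℂ] R := a.toLinearMap.codRestrict R hmem with he
  have hdense : DenseRange e := by
    refine (Topology.IsInducing.subtypeVal.dense_iff).2 fun x => ?_
    have hx : (x : A) ∈ closure (LinearMap.range a.toLinearMap : Set A) := x.2
    convert hx using 2
    ext w
    simp only [Set.mem_image, Set.mem_range, SetLike.mem_coe, LinearMap.mem_range]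
    constructor
    · rintro ⟨_, ⟨y, rfl⟩, rfl⟩; exact ⟨y, rfl⟩
    · rintro ⟨y, rfl⟩; exact ⟨_, ⟨y, rfl⟩, rfl⟩
  have hn : ∀ y, ‖b.toLinearMap y‖ ≤ 1 * ‖e y‖ := fun y => by rw [one_mul]; exact h y
  have : CompleteSpace R := (Submodule.isClosed_topologicalClosure _).completeSpace_coe
  refine ⟨(b.toLinearMap.extendOfNorm e).comp R.orthogonalProjectionOnto, ?_, fun y => ?_⟩
  · refine (ContinuousLinearMap.opNorm_comp_le _ _).trans ?_
    exact mul_le_one₀ (LinearMap.opNorm_extendOfNorm_le hdense zero_le_one hn) (norm_nonneg _)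
      (Submodule.orthogonalProjectionOnto_norm_le R)
  · have h1 : R.orthogonalProjectionOnto (a y) = e y :=
      R.orthogonalProjectionOnto_mem_subspace_eq_self (e y)
    rw [ContinuousLinearMap.comp_apply, h1, LinearMap.extendOfNorm_eq hdense ⟨1, hn⟩]
    rfl

/-- The defect operator `(1 - M M*)^{1/2}` of a contraction. -/
lemma exists_defect_operator {H K : Type*}
    [NormedAddCommGroup H] [InnerProductSpace ℂ H] [CompleteSpace H]
    [NormedAddCommGroup K] [InnerProductSpace ℂ K] [CompleteSpace K]
    (M : H →L[ℂ] K) (hM : ‖M‖ ≤ 1) :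
    ∃ R : K →L[ℂ] K, (∀ x y, inner ℂ (R x) y = inner ℂ x (R y)) ∧
      ∀ y, ‖R y‖ ^ 2 = ‖y‖ ^ 2 - ‖ContinuousLinearMap.adjoint M y‖ ^ 2 := by
  set Q : K →L[ℂ] K := 1 - M.comp (ContinuousLinearMap.adjoint M) with hQ
  have hQi : ∀ y, inner ℂ y (Q y) =
      ((‖y‖ ^ 2 - ‖ContinuousLinearMap.adjoint M y‖ ^ 2 : ℝ) : ℂ) := fun y => by
    rw [hQ, sub_apply, inner_sub_right, one_apply_eq_self,
      ContinuousLinearMap.comp_apply, ← ContinuousLinearMap.adjoint_inner_left,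
      inner_self_eq_norm_sq_to_K, inner_self_eq_norm_sq_to_K]
    push_cast; rfl
  have hQ0 : 0 ≤ Q := by
    rw [ContinuousLinearMap.nonneg_iff_isPositive, ContinuousLinearMap.isPositive_iff_complex]
    intro y
    have h1 : inner ℂ (Q y) y = ((‖y‖ ^ 2 - ‖ContinuousLinearMap.adjoint M y‖ ^ 2 : ℝ) : ℂ) := by
      rw [← inner_conj_symm, hQi, Complex.conj_ofReal]
    have h2 : ‖ContinuousLinearMap.adjoint M y‖ ≤ ‖y‖ := by
      have := (ContinuousLinearMap.adjoint M).le_of_opNorm_le (c := 1)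
        (by rwa [LinearIsometryEquiv.norm_map]) y
      rwa [one_mul] at this
    rw [h1]
    have h3 := pow_le_pow_left₀ (norm_nonneg _) h2 2
    simp only [RCLike.re_to_complex, Complex.ofReal_re]
    exact ⟨trivial, sub_nonneg.2 h3⟩
  have hsa : IsSelfAdjoint (CFC.sqrt Q) := (CFC.sqrt_nonneg Q).isSelfAdjoint
  have hsym : ∀ x y, inner ℂ (CFC.sqrt Q x) y = inner ℂ x (CFC.sqrt Q y) := hsa.isSymmetric
  refine ⟨CFC.sqrt Q, hsym, fun y => ?_⟩
  have h1 : inner ℂ (CFC.sqrt Q y) (CFC.sqrt Q y) = inner ℂ y (Q y) := by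
    rw [hsym, ← mul_apply_eq_comp, CFC.sqrt_mul_sqrt_self Q hQ0]
  rw [hQi] at h1
  rw [norm_sq_eq_re_inner (𝕜 := ℂ), h1, RCLike.re_to_complex, Complex.ofReal_re]

/-- The lurking isometry argument, in weak form. -/
lemma exists_contractive_colligation {U K : Type*}
    [NormedAddCommGroup U] [InnerProductSpace ℂ U] [CompleteSpace U]
    [NormedAddCommGroup K] [InnerProductSpace ℂ K] [CompleteSpace K]
    (D R W : K →L[ℂ] K) (s : K →L[ℂ] U)
    (h : ∀ y, ‖D y‖ ^ 2 + ‖R (W y)‖ ^ 2 = ‖s y‖ ^ 2 + ‖R y‖ ^ 2) :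
    ∃ (α : U →L[ℂ] K) (B : K →L[ℂ] K) (γ : U →L[ℂ] K) (δ : K →L[ℂ] K),
      (∀ u v, ‖α u + B v‖ ^ 2 + ‖γ u + δ v‖ ^ 2 ≤ ‖u‖ ^ 2 + ‖v‖ ^ 2) ∧
      ∀ y u v, inner ℂ (D y) (α u + B v) + inner ℂ (R (W y)) (γ u + δ v) =
        inner ℂ (s y) u + inner ℂ (R y) v := by
  let a : K →L[ℂ] WithLp 2 (K × K) :=
    (WithLp.prodContinuousLinearEquiv 2 ℂ K K).symm.toContinuousLinearMap.comp (D.prod (R.comp W))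
  let b : K →L[ℂ] WithLp 2 (U × K) :=
    (WithLp.prodContinuousLinearEquiv 2 ℂ U K).symm.toContinuousLinearMap.comp (s.prod R)
  obtain ⟨V, hV1, hV⟩ := exists_contraction_factor a b fun y => by
    refine le_of_sq_le_sq ?_ (norm_nonneg _)
    rw [WithLp.prod_norm_sq_eq_of_L2, WithLp.prod_norm_sq_eq_of_L2]
    exact (h y).ge
  let G := ContinuousLinearMap.adjoint V
  have hG : ∀ w, ‖G w‖ ≤ ‖w‖ := fun w => by
    have := G.le_of_opNorm_le (c := 1) (by rwa [LinearIsometryEquiv.norm_map]) w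
    rwa [one_mul] at this
  let i₁ : U →L[ℂ] WithLp 2 (U × K) :=
    (WithLp.prodContinuousLinearEquiv 2 ℂ U K).symm.toContinuousLinearMap.comp
      (ContinuousLinearMap.inl ℂ U K)
  let i₂ : K →L[ℂ] WithLp 2 (U × K) :=
    (WithLp.prodContinuousLinearEquiv 2 ℂ U K).symm.toContinuousLinearMap.comp
      (ContinuousLinearMap.inr ℂ U K)
  let q := (WithLp.prodContinuousLinearEquiv 2 ℂ K K).toContinuousLinearMap
  let p₁ : WithLp 2 (K × K) →L[ℂ] K := (ContinuousLinearMap.fst ℂ K K).comp q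
  let p₂ : WithLp 2 (K × K) →L[ℂ] K := (ContinuousLinearMap.snd ℂ K K).comp q
  have hi : ∀ u v, i₁ u + i₂ v = WithLp.toLp 2 (u, v) := fun u v => by
    refine (WithLp.prodContinuousLinearEquiv 2 ℂ U K).injective ?_
    rw [map_add]
    show (u, (0 : K)) + ((0 : U), v) = (u, v)
    simp
  have h1 : ∀ u v, (p₁.comp (G.comp i₁)) u + (p₁.comp (G.comp i₂)) v =
      (G (WithLp.toLp 2 (u, v))).fst := fun u v => by
    rw [← hi, map_add]; rfl
  have h2 : ∀ u v, (p₂.comp (G.comp i₁)) u + (p₂.comp (G.comp i₂)) v =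
      (G (WithLp.toLp 2 (u, v))).snd := fun u v => by
    rw [← hi, map_add]; rfl
  refine ⟨p₁.comp (G.comp i₁), p₁.comp (G.comp i₂), p₂.comp (G.comp i₁), p₂.comp (G.comp i₂),
    fun u v => ?_, fun y u v => ?_⟩
  · rw [h1, h2, ← WithLp.prod_norm_sq_eq_of_L2]
    refine (pow_le_pow_left₀ (norm_nonneg _) (hG _) 2).trans ?_
    rw [WithLp.prod_norm_sq_eq_of_L2]
    exact le_rfl
  · rw [h1, h2]
    have h3 : inner ℂ (a y) (G (WithLp.toLp 2 (u, v))) = inner ℂ (b y) (WithLp.toLp 2 (u, v)) := by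
      rw [ContinuousLinearMap.adjoint_inner_right, hV]
    rw [WithLp.prod_inner_apply, WithLp.prod_inner_apply] at h3
    exact h3

/-- Taylor coefficients of the transfer function of a colligation. -/
def transferCoeff {U V K : Type*}
    [NormedAddCommGroup U] [NormedSpace ℂ U] [NormedAddCommGroup V] [NormedSpace ℂ V]
    [NormedAddCommGroup K] [NormedSpace ℂ K]
    (α : U →L[ℂ] V) (B : K →L[ℂ] V) (γ : U →L[ℂ] K) (δ : K →L[ℂ] K) : ℕ → (U →L[ℂ] V)
  | 0 => α
  | k + 1 => B.comp ((δ ^ k).comp γ)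

/-- The transfer function of a contractive colligation is in the Schur class. -/
lemma exists_isSchur_transfer {U V K : Type*}
    [NormedAddCommGroup U] [InnerProductSpace ℂ U]
    [NormedAddCommGroup V] [InnerProductSpace ℂ V] [CompleteSpace V]
    [NormedAddCommGroup K] [InnerProductSpace ℂ K] [CompleteSpace K]
    (α : U →L[ℂ] V) (B : K →L[ℂ] V) (γ : U →L[ℂ] K) (δ : K →L[ℂ] K)
    (h : ∀ u v, ‖α u + B v‖ ^ 2 + ‖γ u + δ v‖ ^ 2 ≤ ‖u‖ ^ 2 + ‖v‖ ^ 2) :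
    ∃ F : ℂ → (U →L[ℂ] V), IsSchur F ∧ ∀ z ∈ ball (0 : ℂ) 1, ∀ u,
      HasSum (fun k => z ^ k • transferCoeff α B γ δ k u) (F z u) := by
  have hδ : ‖δ‖ ≤ 1 := by
    refine δ.opNorm_le_bound zero_le_one fun v => ?_
    have := h 0 v
    simp only [map_zero, zero_add, norm_zero] at this
    rw [one_mul]
    exact le_of_sq_le_sq (by nlinarith [sq_nonneg ‖B v‖]) (norm_nonneg _)
  have hzδ : ∀ z ∈ ball (0 : ℂ) 1, ‖z • δ‖ < 1 := fun z hz => by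
    have hz' : ‖z‖ < 1 := by simpa using hz
    rw [norm_smul]
    exact (mul_le_of_le_one_right (norm_nonneg _) hδ).trans_lt hz'
  set I : ℂ → (K →L[ℂ] K) := fun z => Ring.inverse (1 - z • δ) with hI
  set F : ℂ → (U →L[ℂ] V) := fun z => α + z • B.comp ((I z).comp γ) with hF
  have hIdiff : DifferentiableOn ℂ I (ball 0 1) := by
    intro z hz
    have h1 : DifferentiableAt ℂ Ring.inverse (1 - z • δ) := by
      have := differentiableAt_inverse (𝕜 := ℂ) (Units.oneSub (z • δ) (hzδ z hz)).isUnit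
      exact this
    exact (DifferentiableAt.comp (f := fun z : ℂ => (1 : K →L[ℂ] K) - z • δ) z h1
      (by fun_prop)).differentiableWithinAt
  have hexp : ∀ z ∈ ball (0 : ℂ) 1, ∀ u,
      HasSum (fun k => z ^ k • transferCoeff α B γ δ k u) (F z u) := by
    intro z hz u
    have h1 : HasSum (fun k : ℕ => (z • δ) ^ k) (I z) := by
      have h2 := summable_geometric_of_norm_lt_one (hzδ z hz)
      have h3 := geom_series_eq_inverse (z • δ) (hzδ z hz)
      simp only [hI]
      rw [← h3]
      exact h2.hasSum
    have h4 : HasSum (fun k : ℕ => ((z • δ) ^ k) (γ u)) (I z (γ u)) :=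
      (ContinuousLinearMap.apply ℂ K (γ u)).hasSum h1
    have h5 := (B.hasSum h4).const_smul z
    rw [← hasSum_nat_add_iff' 1]
    simp only [Finset.range_one, Finset.sum_singleton, pow_zero, one_smul]
    convert h5 using 1
    · ext k
      simp [transferCoeff, smul_pow, pow_succ', smul_smul]
    · simp [hF, transferCoeff]
  refine ⟨F, ⟨?_, fun z hz => ?_⟩, hexp⟩
  · refine DifferentiableOn.analyticOn ?_ isOpen_ball
    intro z hz
    have h1 := hIdiff z hz
    refine (differentiableWithinAt_const α).fun_add (differentiableWithinAt_id.fun_smul ?_)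
    exact (differentiableWithinAt_const B).clm_comp (h1.clm_comp (differentiableWithinAt_const γ))
  · refine (F z).opNorm_le_bound zero_le_one fun u => ?_
    have hz' : ‖z‖ < 1 := by simpa using hz
    set x := I z (γ u) with hx
    have hres : γ u + δ (z • x) = x := by
      have h1 : (1 - z • δ) * I z = 1 :=
        Ring.mul_inverse_cancel _ (Units.oneSub (z • δ) (hzδ z hz)).isUnit
      have h2 := congrArg (fun A : K →L[ℂ] K => A (γ u)) h1
      simp only [mul_apply_eq_comp, sub_apply,
        one_apply_eq_self, smul_apply, ← hx] at h2
      rw [map_smul, ← h2]; abel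
    have h3 := h u (z • x)
    have h4 : α u + B (z • x) = F z u := by simp [hF, hx]
    rw [hres, h4, norm_smul] at h3
    rw [one_mul]
    refine le_of_sq_le_sq ?_ (norm_nonneg _)
    have : (‖z‖ * ‖x‖) ^ 2 ≤ ‖x‖ ^ 2 :=
      pow_le_pow_left₀ (by positivity) (mul_le_of_le_one_left (norm_nonneg _) hz'.le) 2
    linarith

/-- A linear map into sequences whose values are square summable with contractive norm bound is a
contraction into `ℓ²`. -/
lemma exists_contraction_lp_two {A Y : Type*}
    [NormedAddCommGroup A] [NormedSpace ℂ A] [NormedAddCommGroup Y] [NormedSpace ℂ Y]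
    (g : A →ₗ[ℂ] (ℕ → Y))
    (hg : ∀ x, Summable (fun ℓ => ‖g x ℓ‖ ^ 2) ∧ ∑' ℓ, ‖g x ℓ‖ ^ 2 ≤ ‖x‖ ^ 2) :
    ∃ L : A →L[ℂ] lp (fun _ : ℕ => Y) 2, ‖L‖ ≤ 1 ∧ ∀ x ℓ, L x ℓ = g x ℓ := by
  let G : A →ₗ[ℂ] lp (fun _ : ℕ => Y) 2 :=
    { toFun := fun x => ⟨g x, memℓp_gen (by simpa using (hg x).1)⟩
      map_add' := fun x y => Subtype.ext (map_add g x y)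
      map_smul' := fun a x => Subtype.ext (map_smul g a x) }
  have hG : ∀ x, ‖G x‖ ≤ 1 * ‖x‖ := fun x => by
    rw [one_mul]
    refine le_of_sq_le_sq ?_ (norm_nonneg _)
    rw [← (lp_two_hasSum_norm_sq (G x)).tsum_eq]
    exact (hg x).2
  exact ⟨G.mkContinuous 1 hG, G.mkContinuous_norm_le zero_le_one hG, fun x ℓ => rfl⟩

/-- The weighted backward shift `(y_ℓ) ↦ (w_ℓ y_{ℓ+n})` on `ℓ²`. -/
lemma exists_weighted_shift (Y : Type*) [NormedAddCommGroup Y] [NormedSpace ℂ Y]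
    (w : ℕ → ℝ) (hw0 : ∀ ℓ, 0 ≤ w ℓ) (hw1 : ∀ ℓ, w ℓ ≤ 1) (n : ℕ) :
    ∃ A : lp (fun _ : ℕ => Y) 2 →L[ℂ] lp (fun _ : ℕ => Y) 2,
      ∀ y ℓ, A y ℓ = (w ℓ : ℂ) • y (ℓ + n) := by
  let g : lp (fun _ : ℕ => Y) 2 →ₗ[ℂ] (ℕ → Y) :=
    { toFun := fun y ℓ => (w ℓ : ℂ) • y (ℓ + n)
      map_add' := fun x y => by ext ℓ; simp
      map_smul' := fun a x => by ext ℓ; simp [smul_comm a] }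
  obtain ⟨L, -, hL⟩ := exists_contraction_lp_two g fun y => by
    have h1 := lp_two_hasSum_norm_sq y
    have h2 : ∀ ℓ, ‖g y ℓ‖ ^ 2 ≤ ‖y (ℓ + n)‖ ^ 2 := fun ℓ => by
      refine pow_le_pow_left₀ (norm_nonneg _) ?_ 2
      show ‖(w ℓ : ℂ) • y (ℓ + n)‖ ≤ _
      rw [norm_smul, Complex.norm_real, Real.norm_of_nonneg (hw0 ℓ)]
      exact mul_le_of_le_one_left (norm_nonneg _) (hw1 ℓ)
    have h3 : Summable fun ℓ => ‖y (ℓ + n)‖ ^ 2 := (summable_nat_add_iff n).2 h1.summable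
    have h4 := Summable.of_nonneg_of_le (fun ℓ => sq_nonneg _) h2 h3
    refine ⟨h4, (h4.tsum_le_tsum h2 h3).trans ?_⟩
    rw [← h1.tsum_eq, ← h1.summable.sum_add_tsum_nat_add n]
    exact le_add_of_nonneg_left (Finset.sum_nonneg fun _ _ => sq_nonneg _)
  exact ⟨L, hL⟩

/-- The multiplication operator of a contractive multiplier, transplanted to `ℓ²`. -/
lemma exists_multiplication_operator {U Y : Type*} {β : ℕ → ℝ}
    [NormedAddCommGroup U] [InnerProductSpace ℂ U] [NormedAddCommGroup Y] [InnerProductSpace ℂ Y]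
    (hβ : ∀ j, 0 ≤ β j) {Sc : ℕ → (U →L[ℂ] Y)} (hS : IsContractiveMultiplier β Sc) :
    ∃ M : lp (fun _ : ℕ => U) 2 →L[ℂ] lp (fun _ : ℕ => Y) 2, ‖M‖ ≤ 1 ∧
      ∀ k u ℓ, M (lp.single 2 k u) ℓ = (√(β ℓ) : ℂ) • if k ≤ ℓ then Sc (ℓ - k) u else 0 := by
  let g : lp (fun _ : ℕ => U) 2 →ₗ[ℂ] (ℕ → Y) :=
    { toFun := fun h ℓ => (√(β ℓ) : ℂ) • ∑ j ∈ Finset.range (ℓ + 1), Sc j (h (ℓ - j))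
      map_add' := fun x y => by ext ℓ; simp [Finset.sum_add_distrib]
      map_smul' := fun a x => by ext ℓ; simp [Finset.smul_sum, smul_comm a] }
  have hn : ∀ h ℓ, ‖g h ℓ‖ ^ 2 =
      β ℓ * ‖∑ j ∈ Finset.range (ℓ + 1), Sc j (h (ℓ - j))‖ ^ 2 := fun h ℓ => by
    show ‖(√(β ℓ) : ℂ) • ∑ j ∈ Finset.range (ℓ + 1), Sc j (h (ℓ - j))‖ ^ 2 = _
    rw [norm_smul, Complex.norm_real, Real.norm_of_nonneg (Real.sqrt_nonneg _), mul_pow,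
      Real.sq_sqrt (hβ ℓ)]
  obtain ⟨M, hM, hMg⟩ := exists_contraction_lp_two g fun h => by
    simp only [hn]
    have h1 := lp_two_hasSum_norm_sq h
    have h2 := hS h h1.summable
    rwa [h1.tsum_eq] at h2
  refine ⟨M, hM, fun k u ℓ => ?_⟩
  rw [hMg]
  show (√(β ℓ) : ℂ) • ∑ j ∈ Finset.range (ℓ + 1), Sc j ((lp.single 2 k u : lp (fun _ : ℕ => U) 2) (ℓ - j)) = _
  congr 1
  split_ifs with hk
  · rw [Finset.sum_eq_single (ℓ - k)]
    · rw [Nat.sub_sub_self hk, lp.single_apply_self]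
    · intro j hj hne
      rw [Finset.mem_range] at hj
      rw [lp.single_apply_ne _ _ _ (by omega), map_zero]
    · intro h
      exact absurd (Finset.mem_range.2 (by omega)) h
  · refine Finset.sum_eq_zero fun j _ => ?_
    rw [lp.single_apply_ne _ _ _ (by omega), map_zero]

/-- A contractive multiplier from `H²(U)` to `H²_β(Y)` factors through the transfer function of a
contractive colligation. -/
lemma exists_colligation_of_multiplier {U Y : Type*} {β c : ℕ → ℝ}
    [NormedAddCommGroup U] [InnerProductSpace ℂ U] [CompleteSpace U]
    [NormedAddCommGroup Y] [InnerProductSpace ℂ Y] [CompleteSpace Y]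
    (hβ : IsWeightSeq β) (hmono : ∀ j, β (j + 1) ≤ β j) (hc0 : c 0 = 1)
    (hcs : ∀ j, c (j + 1) = (β (j + 1))⁻¹ - (β j)⁻¹)
    {Sc : ℕ → (U →L[ℂ] Y)} (hS : IsContractiveMultiplier β Sc) :
    ∃ (α : U →L[ℂ] lp (fun _ : ℕ => Y) 2)
      (B : lp (fun _ : ℕ => Y) 2 →L[ℂ] lp (fun _ : ℕ => Y) 2)
      (γ : U →L[ℂ] lp (fun _ : ℕ => Y) 2)
      (δ : lp (fun _ : ℕ => Y) 2 →L[ℂ] lp (fun _ : ℕ => Y) 2),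
      (∀ u v, ‖α u + B v‖ ^ 2 + ‖γ u + δ v‖ ^ 2 ≤ ‖u‖ ^ 2 + ‖v‖ ^ 2) ∧
      ∀ m u, Sc m u = ∑ p ∈ Finset.HasAntidiagonal.antidiagonal m,
        (√(c p.1) : ℂ) • (transferCoeff α B γ δ p.2 u) p.1 := by
  have hpos := hβ.1
  have hc := weight_increment_nonneg hβ hmono hc0 hcs
  have hβc : ∀ ℓ, β (ℓ + 1) * c (ℓ + 1) + β (ℓ + 1) / β ℓ = 1 := fun ℓ => by
    have h1 := (hpos ℓ).ne'
    have h2 := (hpos (ℓ + 1)).ne'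
    rw [hcs]; field_simp; ring
  have hβc1 : ∀ ℓ, β ℓ * c ℓ ≤ 1 := fun ℓ => by
    cases ℓ with
    | zero => simp [hβ.2.1, hc0]
    | succ ℓ => linarith [hβc ℓ, div_pos (hpos (ℓ + 1)) (hpos ℓ)]
  obtain ⟨M, hM1, hMs⟩ := exists_multiplication_operator (fun j => (hpos j).le) hS
  obtain ⟨D, hD⟩ := exists_weighted_shift Y (fun ℓ => √(β ℓ * c ℓ)) (fun _ => Real.sqrt_nonneg _)
    (fun ℓ => Real.sqrt_le_one.2 (hβc1 ℓ)) 0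
  obtain ⟨W, hW⟩ := exists_weighted_shift Y (fun ℓ => √(β (ℓ + 1) / β ℓ))
    (fun _ => Real.sqrt_nonneg _)
    (fun ℓ => Real.sqrt_le_one.2 ((div_le_one (hpos ℓ)).2 (hmono ℓ))) 1
  simp only [add_zero] at hD
  obtain ⟨R, hRs, hRn⟩ := exists_defect_operator M hM1
  have hω : ∀ ℓ, √(β (ℓ + 1) / β ℓ) * √(β ℓ) = √(β (ℓ + 1)) := fun ℓ => by
    rw [← Real.sqrt_mul (div_pos (hpos (ℓ + 1)) (hpos ℓ)).le, div_mul_cancel₀ _ (hpos ℓ).ne']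
  have hMW : ∀ y k, ContinuousLinearMap.adjoint M (W y) k =
      ContinuousLinearMap.adjoint M y (k + 1) := fun y k => by
    refine ext_inner_right ℂ fun u => ?_
    rw [← lp.inner_single_right (𝕜 := ℂ) k u (ContinuousLinearMap.adjoint M (W y)),
      ← lp.inner_single_right (𝕜 := ℂ) (k + 1) u (ContinuousLinearMap.adjoint M y),
      ContinuousLinearMap.adjoint_inner_left, ContinuousLinearMap.adjoint_inner_left]
    have h1 := lp.hasSum_inner (𝕜 := ℂ) (W y) (M (lp.single 2 k u))
    have h2 := lp.hasSum_inner (𝕜 := ℂ) y (M (lp.single 2 (k + 1) u))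
    rw [← hasSum_nat_add_iff' 1] at h2
    have h3 : (inner ℂ (y 0) (M (lp.single 2 (k + 1) u) 0) : ℂ) = 0 := by simp [hMs]
    rw [Finset.sum_range_one, h3, sub_zero] at h2
    refine h1.unique ?_
    have he : (fun ℓ => (inner ℂ (W y ℓ) (M (lp.single 2 k u) ℓ) : ℂ)) =
        fun ℓ => inner ℂ (y (ℓ + 1)) (M (lp.single 2 (k + 1) u) (ℓ + 1)) := by
      funext ℓ
      rw [hW, hMs, hMs, inner_smul_left, Complex.conj_ofReal, ← inner_smul_right, smul_smul,
        ← Complex.ofReal_mul, hω]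
      simp
    rw [he]
    exact h2
  let s : lp (fun _ : ℕ => Y) 2 →L[ℂ] U :=
    (lp.evalCLM ℂ (fun _ : ℕ => U) 2 0).comp (ContinuousLinearMap.adjoint M)
  have hnorm : ∀ y, ‖D y‖ ^ 2 + ‖R (W y)‖ ^ 2 = ‖s y‖ ^ 2 + ‖R y‖ ^ 2 := fun y => by
    have h1 : ‖D y‖ ^ 2 + ‖W y‖ ^ 2 = ‖y‖ ^ 2 := by
      have hDs := lp_two_hasSum_norm_sq (D y)
      have hys := lp_two_hasSum_norm_sq y
      rw [← hasSum_nat_add_iff' 1] at hDs hys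
      have h2 := hDs.add (lp_two_hasSum_norm_sq (W y))
      have he : (fun ℓ => ‖D y (ℓ + 1)‖ ^ 2 + ‖W y ℓ‖ ^ 2) = fun ℓ => ‖y (ℓ + 1)‖ ^ 2 := by
        funext ℓ
        rw [hD, hW, norm_smul, norm_smul, Complex.norm_real, Complex.norm_real,
          Real.norm_of_nonneg (Real.sqrt_nonneg _), Real.norm_of_nonneg (Real.sqrt_nonneg _),
          mul_pow, mul_pow, Real.sq_sqrt (mul_nonneg (hpos _).le (hc _)),
          Real.sq_sqrt (div_pos (hpos (ℓ + 1)) (hpos ℓ)).le, ← add_mul, hβc, one_mul]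
      rw [he] at h2
      have h3 := h2.unique hys
      have h4 : D y 0 = y 0 := by simp [hD, hβ.2.1, hc0]
      rw [Finset.sum_range_one, Finset.sum_range_one, h4] at h3
      linarith
    have h2 : ‖ContinuousLinearMap.adjoint M (W y)‖ ^ 2 =
        ‖ContinuousLinearMap.adjoint M y‖ ^ 2 - ‖s y‖ ^ 2 := by
      have h3 := lp_two_hasSum_norm_sq (ContinuousLinearMap.adjoint M (W y))
      have h4 := lp_two_hasSum_norm_sq (ContinuousLinearMap.adjoint M y)
      rw [← hasSum_nat_add_iff' 1, Finset.sum_range_one] at h4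
      simp only [hMW] at h3
      exact h3.unique h4
    rw [hRn, hRn, h2]
    linarith
  obtain ⟨α, B, γ, δ, hcon, hcol⟩ := exists_contractive_colligation D R W s hnorm
  refine ⟨α, B, γ, δ, hcon, ?_⟩
  have hs : ∀ ℓ y₀ u, inner ℂ (s (lp.single 2 ℓ y₀)) u =
      inner ℂ y₀ ((√(β ℓ) : ℂ) • Sc ℓ u) := fun ℓ y₀ u => by
    refine (lp.inner_single_right (𝕜 := ℂ) 0 u
      (ContinuousLinearMap.adjoint M (lp.single 2 ℓ y₀))).symm.trans ?_
    rw [ContinuousLinearMap.adjoint_inner_left,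
      lp.inner_single_left, hMs, if_pos (Nat.zero_le _), Nat.sub_zero]
  have hDs : ∀ ℓ (y₀ : Y), D (lp.single 2 ℓ y₀) = (√(β ℓ * c ℓ) : ℂ) • lp.single 2 ℓ y₀ :=
    fun ℓ y₀ => by
      ext i
      rw [hD, lp.coeFn_smul, Pi.smul_apply]
      rcases eq_or_ne i ℓ with rfl | hi
      · rfl
      · rw [lp.single_apply_ne _ _ _ hi, smul_zero, smul_zero]
  have hWs : ∀ ℓ (y₀ : Y), W (lp.single 2 (ℓ + 1) y₀) =
      (√(β (ℓ + 1) / β ℓ) : ℂ) • lp.single 2 ℓ y₀ := fun ℓ y₀ => by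
    ext i
    rw [hW, lp.coeFn_smul, Pi.smul_apply]
    rcases eq_or_ne i ℓ with rfl | hi
    · rw [lp.single_apply_self, lp.single_apply_self]
    · rw [lp.single_apply_ne _ _ _ hi, lp.single_apply_ne _ _ _ (by omega), smul_zero, smul_zero]
  have hW0 : ∀ y₀ : Y, W (lp.single 2 0 y₀) = 0 := fun y₀ => by
    ext i
    rw [hW, lp.single_apply_ne _ _ _ (by omega), smul_zero]
    rfl
  have hzero : ∀ u v, (α u + B v) 0 = Sc 0 u + R v 0 := fun u v => by
    refine ext_inner_left ℂ fun y₀ => ?_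
    have h1 := hcol (lp.single 2 0 y₀) u v
    rw [hDs, hW0, map_zero, inner_zero_left, add_zero, hs, hRs, lp.inner_single_left,
      ← inner_add_right, inner_smul_left, lp.inner_single_left] at h1
    simpa [hβ.2.1, hc0] using h1
  have hsucc : ∀ ℓ u v, (√(β (ℓ + 1) * c (ℓ + 1)) : ℂ) • (α u + B v) (ℓ + 1) +
      (√(β (ℓ + 1) / β ℓ) : ℂ) • R (γ u + δ v) ℓ =
      (√(β (ℓ + 1)) : ℂ) • Sc (ℓ + 1) u + R v (ℓ + 1) := fun ℓ u v => by
    refine ext_inner_left ℂ fun y₀ => ?_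
    have h1 := hcol (lp.single 2 (ℓ + 1) y₀) u v
    rw [hDs, hWs, hs, hRs, hRs, lp.inner_single_left, ← inner_add_right, inner_smul_left,
      inner_smul_left, lp.inner_single_left, lp.inner_single_left, Complex.conj_ofReal,
      Complex.conj_ofReal, ← inner_smul_right, ← inner_smul_right, ← inner_add_right] at h1
    exact h1
  let r : lp (fun _ : ℕ => Y) 2 → ℕ → Y := fun v ℓ => (√(β ℓ) : ℂ)⁻¹ • R v ℓ
  have hstep : ∀ ℓ u v, (√(c (ℓ + 1)) : ℂ) • (α u + B v) (ℓ + 1) + r (γ u + δ v) ℓ =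
      Sc (ℓ + 1) u + r v (ℓ + 1) := fun ℓ u v => by
    have hne : ∀ j, (√(β j) : ℂ) ≠ 0 := fun j =>
      Complex.ofReal_ne_zero.2 (Real.sqrt_pos.2 (hpos j)).ne'
    have h1 := congrArg (fun y => (√(β (ℓ + 1)) : ℂ)⁻¹ • y) (hsucc ℓ u v)
    simp only [smul_add, smul_smul] at h1
    rw [Real.sqrt_mul (hpos _).le, Complex.ofReal_mul, inv_mul_cancel_left₀ (hne _),
      inv_mul_cancel₀ (hne _), one_smul] at h1
    have h2 : (√(β (ℓ + 1)) : ℂ)⁻¹ * (√(β (ℓ + 1) / β ℓ) : ℂ) = (√(β ℓ) : ℂ)⁻¹ := by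
      have h3 := hne ℓ
      have h4 := hne (ℓ + 1)
      rw [inv_mul_eq_iff_eq_mul₀ h4, ← hω, Complex.ofReal_mul, mul_inv_cancel_right₀ h3]
    rw [h2] at h1
    exact h1
  have hr0 : ∀ v, r v 0 = R v 0 := fun v => by simp [r, hβ.2.1]
  have hr : ∀ ℓ v, r v ℓ = ∑ p ∈ Finset.HasAntidiagonal.antidiagonal ℓ,
      (√(c p.1) : ℂ) • (B ((δ ^ p.2) v)) p.1 := by
    intro ℓ
    induction ℓ with
    | zero =>
      intro v
      have h1 := hzero 0 v
      simp only [map_zero, zero_add] at h1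
      simp [hr0, hc0, h1]
    | succ ℓ ih =>
      intro v
      have h1 := hstep ℓ 0 v
      simp only [map_zero, zero_add] at h1
      rw [Finset.Nat.sum_antidiagonal_succ', ← h1, ih]
      simp [pow_succ]
  intro m u
  cases m with
  | zero =>
    have h1 := hzero u 0
    simp only [map_zero, add_zero] at h1
    simp [hc0, transferCoeff, h1]
  | succ ℓ =>
    have h1 := hstep ℓ u 0
    have h2 : r 0 (ℓ + 1) = 0 := by simp [r]
    rw [h2, map_zero, map_zero, add_zero, add_zero, add_zero, hr] at h1
    rw [Finset.Nat.sum_antidiagonal_succ', ← h1]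
    rfl

lemma hasSum_smul_apply {U Y : Type*} [NormedAddCommGroup U] [NormedSpace ℂ U]
    [NormedAddCommGroup Y] [NormedSpace ℂ Y] {a : ℕ → ℂ} {L : ℕ → (U →L[ℂ] Y)} {A : U →L[ℂ] Y}
    (h : HasSum (fun j => a j • L j) A) (u : U) : HasSum (fun j => a j • L j u) (A u) := by
  simpa only [ContinuousLinearMap.apply_apply, smul_apply] using
    (ContinuousLinearMap.apply ℂ Y u).hasSum h

/-- The Taylor coefficients of `Ψ_β F` are the weighted antidiagonal sums of those of `F`. -/
lemma taylor_coeff_eq_of_schur {U Y : Type*} {β c : ℕ → ℝ}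
    [NormedAddCommGroup U] [InnerProductSpace ℂ U] [CompleteSpace U]
    [NormedAddCommGroup Y] [InnerProductSpace ℂ Y] [CompleteSpace Y]
    (hβ : IsWeightSeq β) (hmono : ∀ j, β (j + 1) ≤ β j) (hc0 : c 0 = 1)
    (hcs : ∀ j, c (j + 1) = (β (j + 1))⁻¹ - (β j)⁻¹)
    {F : ℂ → (U →L[ℂ] lp (fun _ : ℕ => Y) 2)} {Fc : ℕ → ℕ → (U →L[ℂ] Y)}
    (hF : ∀ z ∈ ball (0 : ℂ) 1, ‖F z‖ ≤ 1)
    (hFc : ∀ (j : ℕ), ∀ z ∈ ball (0 : ℂ) 1, ∀ u : U,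
      HasSum (fun k => z ^ k • Fc j k u) ((F z u) j))
    {S : ℂ → (U →L[ℂ] Y)} {Sc : ℕ → (U →L[ℂ] Y)}
    (hTaylor : ∀ z ∈ ball (0 : ℂ) 1, HasSum (fun j => z ^ j • Sc j) (S z))
    (hSF : ∀ z ∈ ball (0 : ℂ) 1, ∀ u : U,
      HasSum (fun j => ((√(c j) : ℂ) * z ^ j) • (F z u) j) (S z u)) (m : ℕ) (u : U) :
    Sc m u = ∑ p ∈ Finset.HasAntidiagonal.antidiagonal m, (√(c p.1) : ℂ) • Fc p.1 p.2 u := by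
  rw [← sub_eq_zero]
  refine coeff_eq_zero_of_hasSum_zero (a := fun m => Sc m u -
    ∑ p ∈ Finset.HasAntidiagonal.antidiagonal m, (√(c p.1) : ℂ) • Fc p.1 p.2 u)
    (fun z hz => ?_) m
  obtain ⟨A, hA1, hA2⟩ := exists_hasSum_schur_expansion hβ hmono hc0 hcs hF hFc hz u
  have h1 : HasSum (fun j => z ^ j • Sc j u) (S z u) :=
    hasSum_smul_apply (hTaylor z hz) u
  have h2 := h1.sub hA2
  rw [hA1.unique (hSF z hz u), sub_self] at h2
  simpa only [smul_sub] using h2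

theorem stmt7 {X U Y : Type*}
    [NormedAddCommGroup X] [InnerProductSpace ℂ X] [CompleteSpace X]
    [NormedAddCommGroup U] [InnerProductSpace ℂ U] [CompleteSpace U]
    [NormedAddCommGroup Y] [InnerProductSpace ℂ Y] [CompleteSpace Y]
    (β : ℕ → ℝ) (hβ : IsWeightSeq β) (hmono : ∀ j, β (j + 1) ≤ β j)
    (c : ℕ → ℝ) (hc0 : c 0 = 1) (hcs : ∀ j, c (j + 1) = (β (j + 1))⁻¹ - (β j)⁻¹)
    (T : X →L[ℂ] X) (E : X →L[ℂ] Y) (N : X →L[ℂ] U)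
    (hET : OutputStable β E T)
    (S : ℂ → (U →L[ℂ] Y)) (Sc : ℕ → (U →L[ℂ] Y))
    (hTaylor : ∀ z ∈ ball (0 : ℂ) 1, HasSum (fun j => z ^ j • Sc j) (S z)) :
    -- `S` is a contractive multiplier satisfying `(E*S)^{∧L}(T*) = N*` ...
    (IsContractiveMultiplier β Sc ∧
      ∀ (u : U) (x : X),
        HasSum (fun j => inner (𝕜 := ℂ) (E ((T ^ j) x)) (Sc j u))
          (inner (𝕜 := ℂ) (N x) u)) ↔
    -- ... iff `S = Ψ_β F` for a Schur-class `F` whose component Taylor coefficients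
    -- `Fc j k` satisfy the transplanted interpolation condition
    (∃ (F : ℂ → (U →L[ℂ] lp (fun _ : ℕ => Y) 2)) (Fc : ℕ → ℕ → (U →L[ℂ] Y)),
      IsSchur F ∧
      (∀ (j : ℕ), ∀ z ∈ ball (0 : ℂ) 1, ∀ u : U,
        HasSum (fun k => z ^ k • Fc j k u) ((F z u) j)) ∧
      (∀ z ∈ ball (0 : ℂ) 1, ∀ u : U,
        HasSum (fun j => ((Real.sqrt (c j) : ℂ) * z ^ j) • (F z u) j) (S z u)) ∧
      (∀ (u : U) (x : X), ∃ t : ℕ → ℂ,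
        (∀ k, HasSum (fun j => (Real.sqrt (c j) : ℂ) *
          inner (𝕜 := ℂ) (E ((T ^ (j + k)) x)) (Fc j k u)) (t k)) ∧
        HasSum t (inner (𝕜 := ℂ) (N x) u))) := by
  constructor
  · rintro ⟨hM, hI⟩
    obtain ⟨α, B, γ, δ, hcon, hS⟩ := exists_colligation_of_multiplier hβ hmono hc0 hcs hM
    obtain ⟨F, hF, hexp⟩ := exists_isSchur_transfer α B γ δ hcon
    let Fc : ℕ → ℕ → (U →L[ℂ] Y) := fun j k =>
      (lp.evalCLM ℂ (fun _ : ℕ => Y) 2 j).comp (transferCoeff α B γ δ k)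
    have hFc : ∀ (j : ℕ), ∀ z ∈ ball (0 : ℂ) 1, ∀ u : U,
        HasSum (fun k => z ^ k • Fc j k u) ((F z u) j) := fun j z hz u => by
      have h1 := (lp.evalCLM ℂ (fun _ : ℕ => Y) 2 j).hasSum (hexp z hz u)
      simp only [map_smul] at h1
      exact h1
    have hSc : ∀ m u, Sc m u = ∑ p ∈ Finset.HasAntidiagonal.antidiagonal m,
        (√(c p.1) : ℂ) • Fc p.1 p.2 u := hS
    refine ⟨F, Fc, hF, hFc, fun z hz u => ?_, fun u x => ?_⟩
    · obtain ⟨A, hA1, hA2⟩ := exists_hasSum_schur_expansion hβ hmono hc0 hcs hF.2 hFc hz u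
      have h1 : HasSum (fun j => z ^ j • Sc j u) (S z u) :=
        hasSum_smul_apply (hTaylor z hz) u
      simp only [hSc] at h1
      rwa [h1.unique hA2]
    · exact (interpolation_iff_of_schur hβ hmono hc0 hcs hF.2 hFc hET hSc u x _).1 (hI u x)
  · rintro ⟨F, Fc, hF, hFc, hSF, hI⟩
    have hSc := taylor_coeff_eq_of_schur hβ hmono hc0 hcs hF.2 hFc hTaylor hSF
    exact ⟨isContractiveMultiplier_of_schur hβ hmono hc0 hcs hF.2 hFc hSc, fun u x =>
      (interpolation_iff_of_schur hβ hmono hc0 hcs hF.2 hFc hET hSc u x _).2 (hI u x)⟩
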